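/- Let p ∈ [0,1] and let K₀ = √(1−p)·I₂, K₁ = √p·[[1,0],[0,0]], K₂ = √p·[[0,0],[0,1]] be the Kraus operators of the qubit dephasing channel. Set ρ'' = Σᵢ₌₀² Σⱼ₌₀² (Kᵢ⊗Kⱼ)·ρ_AB·(Kᵢ⊗Kⱼ)†, the state with the dephasing channel applied to both qubits. Then tr[ρ''·𝔅] = (12 + 8(p−2)p)/√3 = (12 − 16p + 8p²)/√3. -/

import Mathlib

open Matrix Kronecker
open scoped ComplexOrder

noncomputable def σx : Matrix (Fin 2) (Fin 2) ℂ := !![0, 1; 1, 0]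
noncomputable def σy : Matrix (Fin 2) (Fin 2) ℂ := !![0, -Complex.I; Complex.I, 0]
noncomputable def σz : Matrix (Fin 2) (Fin 2) ℂ := !![1, 0; 0, -1]

/-- Bob's observables for the Elegant Bell inequality. -/
noncomputable def B1 : Matrix (Fin 2) (Fin 2) ℂ := (Real.sqrt 3 : ℂ)⁻¹ • (σx - σy + σz)
noncomputable def B2 : Matrix (Fin 2) (Fin 2) ℂ := (Real.sqrt 3 : ℂ)⁻¹ • (σx + σy - σz)
noncomputable def B3 : Matrix (Fin 2) (Fin 2) ℂ := (Real.sqrt 3 : ℂ)⁻¹ • (-σx - σy - σz)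
noncomputable def B4 : Matrix (Fin 2) (Fin 2) ℂ := (Real.sqrt 3 : ℂ)⁻¹ • (-σx + σy + σz)

/-- The EBI Bell operator 𝔅 with Alice's observables A₁ = σx, A₂ = σy, A₃ = σz. -/
noncomputable def EBIop : Matrix (Fin 2 × Fin 2) (Fin 2 × Fin 2) ℂ :=
  σx ⊗ₖ (B1 + B2 - B3 - B4) + σy ⊗ₖ (B1 - B2 + B3 - B4) + σz ⊗ₖ (B1 - B2 - B3 + B4)

/-- The maximally entangled two-qubit state. -/
noncomputable def ρAB : Matrix (Fin 2 × Fin 2) (Fin 2 × Fin 2) ℂ :=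
  (4 : ℂ)⁻¹ • ((1 : Matrix (Fin 2) (Fin 2) ℂ) ⊗ₖ (1 : Matrix (Fin 2) (Fin 2) ℂ)
    + σx ⊗ₖ σx - σy ⊗ₖ σy + σz ⊗ₖ σz)

/-- Kraus operators of the qubit dephasing channel with parameter `p`. -/
noncomputable def dephK (p : ℝ) : Fin 3 → Matrix (Fin 2) (Fin 2) ℂ :=
  ![(Real.sqrt (1 - p) : ℂ) • (1 : Matrix (Fin 2) (Fin 2) ℂ),
    (Real.sqrt p : ℂ) • !![1, 0; 0, 0],
    (Real.sqrt p : ℂ) • !![0, 0; 0, 1]]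

theorem EBIop_eq :
    EBIop = (4 * (Real.sqrt 3 : ℂ)⁻¹) • (σx ⊗ₖ σx - σy ⊗ₖ σy + σz ⊗ₖ σz) := by
  have hx : B1 + B2 - B3 - B4 = (4 * (Real.sqrt 3 : ℂ)⁻¹) • σx := by
    simp only [B1, B2, B3, B4]; module
  have hy : B1 - B2 + B3 - B4 = -((4 * (Real.sqrt 3 : ℂ)⁻¹) • σy) := by
    simp only [B1, B2, B3, B4]; module
  have hz : B1 - B2 - B3 + B4 = (4 * (Real.sqrt 3 : ℂ)⁻¹) • σz := by
    simp only [B1, B2, B3, B4]; module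
  rw [EBIop, hx, hy, hz, ← neg_smul]
  simp only [kronecker_smul]
  module

/-- Local Kraus maps act factorwise on product operators. -/
theorem sum_kronecker_conj {ι κ m n : Type*} [Fintype ι] [Fintype κ] [Fintype m] [Fintype n]
    (K : ι → Matrix m m ℂ) (L : κ → Matrix n n ℂ) (A : Matrix m m ℂ) (B : Matrix n n ℂ) :
    ∑ i, ∑ j, (K i ⊗ₖ L j) * (A ⊗ₖ B) * (K i ⊗ₖ L j)ᴴ
      = (∑ i, K i * A * (K i)ᴴ) ⊗ₖ (∑ j, L j * B * (L j)ᴴ) := by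
  simp only [conjTranspose_kronecker, ← mul_kronecker_mul]
  ext ⟨a, b⟩ ⟨c, d⟩
  simp only [Matrix.sum_apply, kronecker_apply, Finset.sum_mul_sum]

/-- The dephasing channel keeps the diagonal and damps the coherences by `1 - p`. -/
theorem sum_dephK_conj {p : ℝ} (hp0 : 0 ≤ p) (hp1 : p ≤ 1) (a b c d : ℂ) :
    ∑ i, dephK p i * !![a, b; c, d] * (dephK p i)ᴴ
      = !![a, (1 - p) * b; (1 - p) * c, d] := by
  have h0 : (Real.sqrt p : ℂ) * Real.sqrt p = p := by
    exact_mod_cast Real.mul_self_sqrt hp0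
  have h1 : (Real.sqrt (1 - p) : ℂ) * Real.sqrt (1 - p) = 1 - p := by
    exact_mod_cast Real.mul_self_sqrt (sub_nonneg.mpr hp1)
  ext i j
  simp only [Matrix.sum_apply, Fin.sum_univ_three, Matrix.mul_apply, Fin.sum_univ_two,
    conjTranspose_apply]
  fin_cases i <;> fin_cases j <;> simp [dephK]
  · linear_combination a * h0 + a * h1
  · linear_combination b * h1
  · linear_combination c * h1
  · linear_combination d * h0 + d * h1

/-- The maximally entangled state after dephasing both qubits. -/
theorem dephased_ρAB {p : ℝ} (hp0 : 0 ≤ p) (hp1 : p ≤ 1) :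
    ∑ i : Fin 3, ∑ j : Fin 3, (dephK p i ⊗ₖ dephK p j) * ρAB * (dephK p i ⊗ₖ dephK p j)ᴴ
      = (4 : ℂ)⁻¹ • ((1 : Matrix (Fin 2) (Fin 2) ℂ) ⊗ₖ (1 : Matrix (Fin 2) (Fin 2) ℂ)
        + (1 - p : ℂ) ^ 2 • (σx ⊗ₖ σx - σy ⊗ₖ σy) + σz ⊗ₖ σz) := by
  have hI : ∑ i, dephK p i * 1 * (dephK p i)ᴴ = 1 := by
    simpa [← Matrix.one_fin_two] using sum_dephK_conj hp0 hp1 1 0 0 1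
  have hx : ∑ i, dephK p i * σx * (dephK p i)ᴴ = (1 - p : ℂ) • σx := by
    rw [σx, sum_dephK_conj hp0 hp1]; simp
  have hy : ∑ i, dephK p i * σy * (dephK p i)ᴴ = (1 - p : ℂ) • σy := by
    rw [σy, sum_dephK_conj hp0 hp1]; simp
  have hz : ∑ i, dephK p i * σz * (dephK p i)ᴴ = σz := by
    rw [σz, sum_dephK_conj hp0 hp1]; simp
  simp only [ρAB, Matrix.mul_smul, Matrix.smul_mul, mul_add, mul_sub, add_mul, sub_mul,
    ← Finset.smul_sum, Finset.sum_add_distrib, Finset.sum_sub_distrib, sum_kronecker_conj,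
    hI, hx, hy, hz, kronecker_smul, smul_kronecker]
  module

/-- Applying the dephasing channel to both qubits of the maximally entangled
state gives EBI value `(12 + 8(p−2)p)/√3 = (12 − 16p + 8p²)/√3`. -/
theorem dephasing_both_qubits_EBI_value (p : ℝ) (hp0 : 0 ≤ p) (hp1 : p ≤ 1) :
    ((∑ i : Fin 3, ∑ j : Fin 3, (dephK p i ⊗ₖ dephK p j) * ρAB
        * (dephK p i ⊗ₖ dephK p j)ᴴ) * EBIop).trace
      = (((12 + 8 * (p - 2) * p) / Real.sqrt 3 : ℝ) : ℂ) ∧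
    ((12 + 8 * (p - 2) * p) / Real.sqrt 3 : ℝ)
      = ((12 - 16 * p + 8 * p ^ 2) / Real.sqrt 3 : ℝ) := by
  refine ⟨?_, by ring⟩
  have hxx : σx * σx = 1 := by simp [σx, Matrix.one_fin_two]
  have hyy : σy * σy = 1 := by simp [σy, Matrix.one_fin_two]
  have hzz : σz * σz = 1 := by simp [σz, Matrix.one_fin_two]
  have hx : σx.trace = 0 := by simp [σx, Matrix.trace_fin_two]
  have hy : σy.trace = 0 := by simp [σy, Matrix.trace_fin_two]
  have hz : σz.trace = 0 := by simp [σz, Matrix.trace_fin_two]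
  have hxy : (σx * σy).trace = 0 := by simp [σx, σy, Matrix.trace_fin_two]
  have hyz : (σy * σz).trace = 0 := by simp [σy, σz, Matrix.trace_fin_two]
  have hzx : (σz * σx).trace = 0 := by simp [σz, σx, Matrix.trace_fin_two]
  have hyx : (σy * σx).trace = 0 := by rw [trace_mul_comm, hxy]
  have hzy : (σz * σy).trace = 0 := by rw [trace_mul_comm, hyz]
  have hxz : (σx * σz).trace = 0 := by rw [trace_mul_comm, hzx]
  rw [dephased_ρAB hp0 hp1, EBIop_eq]
  simp only [Matrix.mul_smul, Matrix.smul_mul, mul_add, mul_sub, add_mul, sub_mul,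
    ← mul_kronecker_mul, trace_add, trace_sub, trace_smul, trace_kronecker, one_mul,
    hxx, hyy, hzz, hx, hy, hz, hxy, hyz, hzx, hyx, hzy, hxz, trace_one, Fintype.card_fin,
    smul_eq_mul]
  push_cast
  ring
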